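/- Let q be odd, let Q(4,q) be a nonsingular parabolic quadric in PG(4,q) with orthogonal polarity ζ', and let x, y be two distinct 'hyperbolic' points (points p off the quadric for which p^{ζ'} ∩ Q(4,q) is a hyperbolic quadric) such that the line xy is not tangent to Q(4,q). Then xy is a secant line if and only if |x^⊥ ∩ y^⊥| = q(q+1)/2, and xy is an external line if and only if |x^⊥ ∩ y^⊥| = q(q−1)/2, where x^⊥ denotes the set of hyperbolic points lying in the solid x^{ζ'}. -/

import Mathlib

namespace Stmt15

variable {F : Type*} [Field F]

/-- A singular point: a point of the quadric Q(4,q) in PG(4,q). -/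
def Singular (B : LinearMap.BilinForm F (Fin 5 → F))
    (p : Submodule F (Fin 5 → F)) : Prop :=
  Module.finrank F p = 1 ∧ ∀ v ∈ p, B v v = 0

/-- A hyperbolic point: a point off the quadric whose polar solid meets Q(4,q)
in a hyperbolic quadric (i.e. the polar solid contains a singular line). -/
def HyperPt (B : LinearMap.BilinForm F (Fin 5 → F))
    (p : Submodule F (Fin 5 → F)) : Prop :=
  Module.finrank F p = 1 ∧ (∀ v ∈ p, v ≠ 0 → B v v ≠ 0) ∧
  ∃ W : Submodule F (Fin 5 → F), W ≤ B.orthogonal p ∧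
    Module.finrank F W = 2 ∧ ∀ v ∈ W, B v v = 0

/-- x^⊥: the set of hyperbolic points lying in the polar solid of x. -/
def perpSet (B : LinearMap.BilinForm F (Fin 5 → F))
    (x : Submodule F (Fin 5 → F)) : Set (Submodule F (Fin 5 → F)) :=
  {y | HyperPt B y ∧ y ≤ B.orthogonal x}

end Stmt15

namespace Stmt15

variable {F : Type*} [Field F]

theorem hyperPt_span_singleton_iff {B : LinearMap.BilinForm F (Fin 5 → F)} {a : Fin 5 → F} :
    HyperPt B (F ∙ a) ↔ B a a ≠ 0 ∧ ∃ W : Submodule F (Fin 5 → F), (∀ w ∈ W, B a w = 0) ∧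
      Module.finrank F W = 2 ∧ ∀ w ∈ W, B w w = 0 := by
  constructor
  · rintro ⟨h1, h2, W, hW, hW2, hW3⟩
    have ha : a ≠ 0 := by
      rintro rfl
      rw [Submodule.span_zero_singleton, finrank_bot] at h1
      omega
    exact ⟨h2 a (Submodule.mem_span_singleton_self a) ha, W,
      fun w hw => hW hw a (Submodule.mem_span_singleton_self a), hW2, hW3⟩
  · rintro ⟨h, W, hW, hW2, hW3⟩
    have ha : a ≠ 0 := by
      rintro rfl
      simp at h
    refine ⟨finrank_span_singleton ha, ?_, W, ?_, hW2, hW3⟩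
    · intro v hv hv0
      obtain ⟨c, rfl⟩ := Submodule.mem_span_singleton.1 hv
      have hc : c ≠ 0 := by
        rintro rfl
        simp at hv0
      simp [hc, h]
    · intro w hw v hv
      obtain ⟨c, rfl⟩ := Submodule.mem_span_singleton.1 hv
      simp [hW w hw]

theorem HyperPt.exists_eq_span_singleton {B : LinearMap.BilinForm F (Fin 5 → F)}
    {p : Submodule F (Fin 5 → F)} (hp : HyperPt B p) : ∃ a, p = F ∙ a := by
  have : p.IsPrincipal := (Submodule.finrank_le_one_iff_isPrincipal p).1 hp.1.le
  exact this.principal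

/-- Exchanging two orthogonal vectors of the same nonzero norm by a reflection preserves
hyperbolicity of the points they span. -/
theorem HyperPt.span_singleton_of_norm_eq {B : LinearMap.BilinForm F (Fin 5 → F)}
    (hsymm : ∀ u v, B u v = B v u) {a v : Fin 5 → F}
    (ha : HyperPt B (F ∙ a)) (hav : B a v = 0) (hv : B v v = B a a) : HyperPt B (F ∙ v) := by
  obtain ⟨hN, W, hWa, hW2, hW0⟩ := hyperPt_span_singleton_iff.1 ha
  have hva : B v a = 0 := by rw [hsymm, hav]
  have hf : ((B a a)⁻¹ • B (v - a)) (v - a) = 2 := by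
    simp [hav, hva, hv]
    field_simp
    norm_num
  refine hyperPt_span_singleton_iff.2 ⟨hv ▸ hN, W.map (Module.reflection hf).toLinearMap, ?_,
    by rw [← hW2]; exact LinearEquiv.finrank_map_eq _ _, ?_⟩
  · rintro _ ⟨w, hw, rfl⟩
    simp [Module.reflection_apply, hWa w hw, hva, hv]
    field_simp
    ring
  · rintro _ ⟨w, hw, rfl⟩
    simp [Module.reflection_apply, hWa w hw, hva, hav, hv, hW0 w hw, hsymm w v, hsymm w a]
    field_simp
    ring

theorem exists_mem_ne_zero_apply_eq_zero {V : Type*} [AddCommGroup V] [Module F V]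
    {W : Submodule F V} (hW : 1 < Module.finrank F W) (φ : V →ₗ[F] F) :
    ∃ w ∈ W, w ≠ 0 ∧ φ w = 0 := by
  have : FiniteDimensional F W := FiniteDimensional.of_finrank_pos (by omega)
  have := LinearMap.ker_ne_bot_of_finrank_lt (f := φ.domRestrict W) (by simpa using hW)
  obtain ⟨w, hw, hw0⟩ := Submodule.exists_mem_ne_zero_of_ne_bot this
  exact ⟨w, w.2, by simpa using hw0, by simpa using hw⟩

/-- Through a singular point of the polar solid of a hyperbolic point there is a singular line
of that solid. -/
theorem HyperPt.exists_singular_not_mem_span {B : LinearMap.BilinForm F (Fin 5 → F)}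
    (h2 : (2 : F) ≠ 0) (hsymm : ∀ u v, B u v = B v u) {a e : Fin 5 → F} (ha : HyperPt B (F ∙ a))
    (hee : B e e = 0) : ∃ w, B w a = 0 ∧ B w e = 0 ∧ B w w = 0 ∧ w ∉ F ∙ e := by
  obtain ⟨-, W, hWa, hW2, hW0⟩ := hyperPt_span_singleton_iff.1 ha
  by_cases he : e ∈ W
  · obtain ⟨w, hw, hwe⟩ : ∃ w ∈ W, w ∉ F ∙ e := by
      by_contra! h
      have := (Submodule.finrank_mono (show W ≤ F ∙ e from h)).trans (finrank_span_le_card {e})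
      simp [hW2] at this
    have hadd := hW0 _ (W.add_mem hw he)
    simp [hW0 w hw, hee, hsymm e w, ← two_mul] at hadd
    exact ⟨w, by rw [hsymm, hWa w hw], hadd.resolve_left h2, hW0 w hw, hwe⟩
  · obtain ⟨w, hw, hw0, hwe⟩ := exists_mem_ne_zero_apply_eq_zero (by omega) (B e) (W := W)
    refine ⟨w, by rw [hsymm, hWa w hw], by rw [hsymm, hwe], hW0 w hw, fun h => he ?_⟩
    obtain ⟨c, rfl⟩ := Submodule.mem_span_singleton.1 h
    exact (W.smul_mem_iff (by rintro rfl; simp at hw0)).1 hw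

variable (B : LinearMap.BilinForm F (Fin 5 → F))

/-- A configuration adapted to a line spanned by two vectors `a`, `b`: a basis `e, f, g` of the
polar plane of the line, in which `e, f` is a hyperbolic pair orthogonal to `g`. -/
structure IsAdapted (a b e f g : Fin 5 → F) : Prop where
  ee : B e e = 0
  ff : B f f = 0
  ef : B e f = 1
  ae : B a e = 0
  af : B a f = 0
  ag : B a g = 0
  be : B b e = 0
  bf : B b f = 0
  bg : B b g = 0
  eg : B e g = 0
  fg : B f g = 0
  gg : B g g ≠ 0

variable {B}

theorem exists_coords (hsymm : ∀ u v, B u v = B v u) {a b e f g : Fin 5 → F}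
    (hD : B a a * B b b - B a b ^ 2 ≠ 0) (ee : B e e = 0) (ff : B f f = 0) (ef : B e f = 1)
    (ae : B a e = 0) (af : B a f = 0) (ag : B a g = 0) (be : B b e = 0) (bf : B b f = 0)
    (bg : B b g = 0) (eg : B e g = 0) (fg : B f g = 0) (hg : g ≠ 0) (v : Fin 5 → F) :
    ∃ s t x y z : F, v = s • a + t • b + x • e + y • f + z • g := by
  have hli : LinearIndependent F ![a, b, e, f, g] := by
    rw [Fintype.linearIndependent_iff]
    intro c hc
    simp only [Fin.sum_univ_five, Matrix.cons_val] at hc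
    have ha := congrArg (B a) hc
    have hb := congrArg (B b) hc
    have he := congrArg (B e) hc
    have hf := congrArg (B f) hc
    simp only [map_add, map_smul, smul_eq_mul, map_zero, ee, ff, ef, ae, af, ag, be, bf, bg, eg,
      fg, hsymm e a, hsymm f a, hsymm e b, hsymm f b, hsymm f e, hsymm b a, mul_zero, mul_one,
      add_zero, zero_add] at ha hb he hf
    have h0 : c 0 = 0 := (mul_eq_zero.1 (show (B a a * B b b - B a b ^ 2) * c 0 = 0 by
      linear_combination B b b * ha - B a b * hb)).resolve_left hD
    have h1 : c 1 = 0 := (mul_eq_zero.1 (show (B a a * B b b - B a b ^ 2) * c 1 = 0 by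
      linear_combination B a a * hb - B a b * ha)).resolve_left hD
    have h4 : c 4 = 0 := by simpa [h0, h1, he, hf, hg] using hc
    intro i
    fin_cases i <;> assumption
  have hspan := hli.span_eq_top_of_card_eq_finrank (by simp)
  have hv : v ∈ Submodule.span F (Set.range ![a, b, e, f, g]) := hspan ▸ Submodule.mem_top
  obtain ⟨c, rfl⟩ := (Submodule.mem_span_range_iff_exists_fun F).1 hv
  exact ⟨c 0, c 1, c 2, c 3, c 4, by simp [Fin.sum_univ_five]⟩

/-- The polar plane of a nondegenerate line through a hyperbolic point has an adapted basis. -/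
theorem HyperPt.exists_isAdapted (h2 : (2 : F) ≠ 0) (hsymm : ∀ u v, B u v = B v u)
    (hnd : ∀ v, (∀ w, B v w = 0) → v = 0) {a b : Fin 5 → F}
    (hD : B a a * B b b - B a b ^ 2 ≠ 0) (ha : HyperPt B (F ∙ a)) :
    ∃ e f g, IsAdapted B a b e f g := by
  obtain ⟨-, W, hWa, hW2, hW0⟩ := hyperPt_span_singleton_iff.1 ha
  obtain ⟨e, heW, he0, hbe⟩ := exists_mem_ne_zero_apply_eq_zero (by omega) (B b) (W := W)
  have hae := hWa e heW
  have hee := hW0 e heW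
  obtain ⟨w, hw⟩ : ∃ w, B e w ≠ 0 := by
    by_contra! h
    exact he0 (hnd e h)
  obtain ⟨D, hDab⟩ : ∃ D, D = B a a * B b b - B a b ^ 2 := ⟨_, rfl⟩
  have hD0 : D ≠ 0 := hDab ▸ hD
  obtain ⟨f₀, haf₀, hbf₀, hef₀⟩ : ∃ f₀, B a f₀ = 0 ∧ B b f₀ = 0 ∧ B e f₀ = 1 := by
    refine ⟨(B e w)⁻¹ • (w - ((B b b * B a w - B a b * B b w) / D) • a -
      ((B a a * B b w - B a b * B a w) / D) • b), ?_, ?_, ?_⟩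
    · simp
      right
      field_simp
      linear_combination B a w * hDab
    · simp [hsymm b a]
      right
      field_simp
      linear_combination B b w * hDab
    · simp [hsymm e a, hsymm e b, hae, hbe, hw]
  obtain ⟨f, hf⟩ : ∃ f, f = f₀ - (B f₀ f₀ / 2) • e := ⟨_, rfl⟩
  have haf : B a f = 0 := by simp [hf, haf₀, hae]
  have hbf : B b f = 0 := by simp [hf, hbf₀, hbe]
  have hef : B e f = 1 := by simp [hf, hef₀, hee]
  have hff : B f f = 0 := by
    simp [hf, hsymm f₀ e, hef₀, hee]
    field_simp
    ring
  have hker : LinearMap.ker (LinearMap.pi ![B a, B b, B e, B f]) ≠ ⊥ :=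
    LinearMap.ker_ne_bot_of_finrank_lt (by simp)
  obtain ⟨g, hg, hg0⟩ := Submodule.exists_mem_ne_zero_of_ne_bot hker
  have hg' := fun i => congrFun (LinearMap.mem_ker.1 hg) i
  have hag : B a g = 0 := hg' 0
  have hbg : B b g = 0 := hg' 1
  have heg : B e g = 0 := hg' 2
  have hfg : B f g = 0 := hg' 3
  refine ⟨e, f, g, hee, hff, hef, hae, haf, hag, hbe, hbf, hbg, heg, hfg, fun hgg => hg0 ?_⟩
  refine hnd g fun v => ?_
  obtain ⟨s, t, x, y, z, rfl⟩ := exists_coords hsymm hD hee hff hef hae haf hag hbe hbf hbg heg hfg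
    hg0 v
  simp [hsymm g, hag, hbg, heg, hfg, hgg]

namespace IsAdapted

variable {a b e f g : Fin 5 → F}

theorem swap (h : IsAdapted B a b e f g) : IsAdapted B b a e f g :=
  ⟨h.ee, h.ff, h.ef, h.be, h.bf, h.bg, h.ae, h.af, h.ag, h.eg, h.fg, h.gg⟩

theorem exists_coords (h : IsAdapted B a b e f g) (hsymm : ∀ u v, B u v = B v u)
    (hD : B a a * B b b - B a b ^ 2 ≠ 0) (v : Fin 5 → F) :
    ∃ s t x y z : F, v = s • a + t • b + x • e + y • f + z • g :=
  Stmt15.exists_coords hsymm hD h.ee h.ff h.ef h.ae h.af h.ag h.be h.bf h.bg h.eg h.fg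
    (fun hg => h.gg (by simp [hg])) v

/-- The discriminant of a line through a hyperbolic point `a` is, up to squares, determined by
the norms of `a` and of the anisotropic vector of the polar plane of the line. -/
theorem exists_sq_eq (h : IsAdapted B a b e f g) (h2 : (2 : F) ≠ 0) (hsymm : ∀ u v, B u v = B v u)
    (hD : B a a * B b b - B a b ^ 2 ≠ 0) (ha : HyperPt B (F ∙ a)) :
    ∃ r, -(B a a * B b b - B a b ^ 2) * r ^ 2 = B g g * B a a := by
  obtain ⟨w, hwa, hwe, hww, hw⟩ := ha.exists_singular_not_mem_span h2 hsymm h.ee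
  have hN := (hyperPt_span_singleton_iff.1 ha).1
  obtain ⟨s, t, x, y, z, rfl⟩ := h.exists_coords hsymm hD w
  simp [hsymm f e, hsymm g e, h.ee, h.ef, h.ae, h.be, h.eg] at hwe
  subst hwe
  simp [hsymm e a, hsymm g a, hsymm b a, h.ae, h.ag] at hwa
  simp [hsymm e a, hsymm e b, hsymm g a, hsymm g b, hsymm g e, hsymm b a, h.ae, h.ag, h.be, h.bg,
    h.eg, h.ee] at hww
  have key : t ^ 2 * (B a a * B b b - B a b ^ 2) + z ^ 2 * (B g g * B a a) = 0 := by
    linear_combination B a a * hww - (s * B a a + t * B a b) * hwa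
  have hz : z ≠ 0 := by
    rintro rfl
    have ht : t = 0 := by simpa [hD] using key
    have hs : s = 0 := by simpa [ht, hN] using hwa
    exact hw (by simp [hs, ht, Submodule.mem_span_singleton])
  refine ⟨t / z, ?_⟩
  field_simp
  linear_combination -key

end IsAdapted

/-- Orthogonal hyperbolic points have norms in the same square class. -/
theorem HyperPt.exists_sq_norm_eq (h2 : (2 : F) ≠ 0) (hsymm : ∀ u v, B u v = B v u)
    (hnd : ∀ v, (∀ w, B v w = 0) → v = 0) {a b : Fin 5 → F} (hab : B a b = 0)
    (ha : HyperPt B (F ∙ a)) (hb : HyperPt B (F ∙ b)) : ∃ c, c ≠ 0 ∧ c ^ 2 * B b b = B a a := by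
  have hN := (hyperPt_span_singleton_iff.1 ha).1
  have hM := (hyperPt_span_singleton_iff.1 hb).1
  have hD : B a a * B b b - B a b ^ 2 ≠ 0 := by simp [hab, hN, hM]
  obtain ⟨e, f, g, h⟩ := ha.exists_isAdapted h2 hsymm hnd hD
  have hba : B b a = 0 := by rw [hsymm, hab]
  obtain ⟨r, hr⟩ := h.exists_sq_eq h2 hsymm hD ha
  obtain ⟨r', hr'⟩ := h.swap.exists_sq_eq h2 hsymm (by simp [hba, hN, hM]) hb
  have hr1 : -B b b * r ^ 2 = B g g :=
    mul_right_cancel₀ hN (by linear_combination hr - r ^ 2 * B a b * hab)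
  have hr2 : -B a a * r' ^ 2 = B g g :=
    mul_right_cancel₀ hM (by linear_combination hr' - r' ^ 2 * B b a * hba)
  have hr0 : r ≠ 0 := by
    rintro rfl
    exact h.gg (by simpa using hr1.symm)
  have hr0' : r' ≠ 0 := by
    rintro rfl
    exact h.gg (by simpa using hr2.symm)
  refine ⟨r / r', div_ne_zero hr0 hr0', ?_⟩
  field_simp
  linear_combination hr2 - hr1

section Counting

variable [Fintype F] [DecidableEq F]

open Finset

theorem card_filter_two_mul_mul_eq (h2 : (2 : F) ≠ 0) (c : F) :
    #{p : F × F | 2 * p.1 * p.2 = c} =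
      Fintype.card F - 1 + if c = 0 then Fintype.card F else 0 := by
  have h : ∀ x : F, (∑ y, if 2 * x * y = c then 1 else 0) =
      if x = 0 then (if c = 0 then Fintype.card F else 0) else 1 := by
    intro x
    split_ifs with hx hc
    · simp [hx, hc]
    · simp [hx, Ne.symm hc]
    · have : ∀ y, 2 * x * y = c ↔ y = c / (2 * x) := fun y => by
        field_simp
      simp [this]
  rw [card_filter, Fintype.sum_prod_type]
  simp only [h]
  rw [sum_ite, sum_const, sum_const, filter_eq', filter_ne']
  simp [card_erase_of_mem, add_comm]

theorem card_filter_ternary (h2 : (2 : F) ≠ 0) (γ n : F) :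
    #{p : F × F × F | 2 * p.2.1 * p.2.2 + γ * p.1 ^ 2 = n} =
      Fintype.card F * (Fintype.card F - 1) + #{z : F | γ * z ^ 2 = n} * Fintype.card F := by
  have h : ∀ z : F, (∑ p : F × F, if 2 * p.1 * p.2 + γ * z ^ 2 = n then 1 else 0) =
      Fintype.card F - 1 + if γ * z ^ 2 = n then Fintype.card F else 0 := by
    intro z
    have hz := card_filter_two_mul_mul_eq h2 (n - γ * z ^ 2)
    simp only [eq_sub_iff_add_eq, card_filter] at hz
    rw [hz]
    simp only [sub_eq_zero, eq_comm (a := n)]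
  rw [card_filter, Fintype.sum_prod_type]
  simp only [h]
  rw [sum_add_distrib, ← sum_filter]
  simp

/-- The hyperbolic points of the polar plane of `⟨a, b⟩` correspond two-to-one to the vectors of
norm `B a a` in that plane. -/
theorem IsAdapted.two_mul_ncard_perpSet_inter {a b e f g : Fin 5 → F}
    (h : IsAdapted B a b e f g) (h2 : (2 : F) ≠ 0) (hsymm : ∀ u v, B u v = B v u)
    (hnd : ∀ v, (∀ w, B v w = 0) → v = 0)
    (hD : B a a * B b b - B a b ^ 2 ≠ 0) (ha : HyperPt B (F ∙ a)) :
    2 * (perpSet B (F ∙ a) ∩ perpSet B (F ∙ b)).ncard =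
      #{p : F × F × F | 2 * p.2.1 * p.2.2 + B g g * p.1 ^ 2 = B a a} := by
  classical
  have hN := (hyperPt_span_singleton_iff.1 ha).1
  obtain ⟨ψ, hψ⟩ : ∃ ψ : F × F × F → Fin 5 → F, ∀ p, ψ p = p.2.1 • e + p.2.2 • f + p.1 • g :=
    ⟨_, fun _ => rfl⟩
  have hψe : ∀ p, B e (ψ p) = p.2.2 := fun p => by simp [hψ, h.ee, h.ef, h.eg]
  have hψf : ∀ p, B f (ψ p) = p.2.1 := fun p => by simp [hψ, hsymm f e, h.ff, h.ef, h.fg]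
  have hψg : ∀ p, B g (ψ p) = B g g * p.1 := fun p => by
    simp [hψ, hsymm g e, hsymm g f, h.eg, h.fg, mul_comm]
  have hψa : ∀ p, B a (ψ p) = 0 := fun p => by simp [hψ, h.ae, h.af, h.ag]
  have hψb : ∀ p, B b (ψ p) = 0 := fun p => by simp [hψ, h.be, h.bf, h.bg]
  have hψinj : Function.Injective ψ := by
    intro p p' hp
    refine Prod.ext ?_ (Prod.ext ?_ ?_)
    · exact mul_left_cancel₀ h.gg (by rw [← hψg, ← hψg, hp])
    · rw [← hψf, ← hψf, hp]
    · rw [← hψe, ← hψe, hp]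
  have hψsmul : ∀ (c : F) p, ψ (c • p) = c • ψ p := fun c p => by
    simp [hψ, mul_smul]
  have hψnorm : ∀ p, B (ψ p) (ψ p) = 2 * p.2.1 * p.2.2 + B g g * p.1 ^ 2 := fun p => by
    nth_rewrite 1 [hψ]
    simp [hψe, hψf, hψg]
    ring
  set S : Finset (F × F × F) := {p | 2 * p.2.1 * p.2.2 + B g g * p.1 ^ 2 = B a a} with hS
  have hmemS : ∀ p, p ∈ S ↔ B (ψ p) (ψ p) = B a a := fun p => by simp [hS, hψnorm]
  have himage : perpSet B (F ∙ a) ∩ perpSet B (F ∙ b) = (S.image fun p => F ∙ ψ p : Finset _) := by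
    ext y
    simp only [perpSet, Set.mem_inter_iff, Set.mem_ofPred_eq, coe_image, Set.mem_image, mem_coe,
      hmemS]
    constructor
    · rintro ⟨⟨hy, hya⟩, -, hyb⟩
      obtain ⟨v, rfl⟩ := hy.exists_eq_span_singleton
      have hv := Submodule.mem_span_singleton_self (R := F) v
      have hav : B a v = 0 := hya hv a (Submodule.mem_span_singleton_self a)
      have hbv : B b v = 0 := hyb hv b (Submodule.mem_span_singleton_self b)
      obtain ⟨c, hc, hcv⟩ := ha.exists_sq_norm_eq h2 hsymm hnd hav hy
      obtain ⟨s, t, x, y, z, rfl⟩ := h.exists_coords hsymm hD v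
      simp only [map_add, map_smul, smul_eq_mul, h.ae, h.af, h.ag, h.be, h.bf, h.bg, hsymm b a,
        mul_zero, add_zero] at hav hbv
      have hs : s = 0 := (mul_eq_zero.1 (show (B a a * B b b - B a b ^ 2) * s = 0 by
        linear_combination B b b * hav - B a b * hbv)).resolve_left hD
      have ht : t = 0 := (mul_eq_zero.1 (show (B a a * B b b - B a b ^ 2) * t = 0 by
        linear_combination B a a * hbv - B a b * hav)).resolve_left hD
      have hv' : s • a + t • b + x • e + y • f + z • g = ψ (z, x, y) := by simp [hs, ht, hψ]
      rw [hv'] at hcv ⊢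
      refine ⟨c • (z, x, y), ?_, ?_⟩
      · rw [hψsmul, ← hcv]
        simp
        ring
      · rw [hψsmul]
        exact Submodule.span_singleton_smul_eq hc.isUnit _
    · rintro ⟨p, hp, rfl⟩
      have hperp : ∀ d, B d (ψ p) = 0 → (F ∙ ψ p) ≤ B.orthogonal (F ∙ d) := by
        intro d hd
        rw [Submodule.span_singleton_le_iff_mem]
        intro w hw
        obtain ⟨c, rfl⟩ := Submodule.mem_span_singleton.1 hw
        simp [hd]
      have := ha.span_singleton_of_norm_eq hsymm (hψa p) hp
      exact ⟨⟨this, hperp a (hψa p)⟩, this, hperp b (hψb p)⟩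
  rw [himage, Set.ncard_coe_finset, card_eq_sum_card_image (fun p => F ∙ ψ p) S, mul_comm,
    ← smul_eq_mul, ← sum_const]
  refine sum_congr rfl fun y hy => ?_
  obtain ⟨p, hp, rfl⟩ := mem_image.1 hy
  rw [hmemS] at hp
  have hp0 : p ≠ -p := by
    intro hpp
    have : ψ p = (-1 : F) • ψ p := by rw [← hψsmul, neg_one_smul, ← hpp]
    have h2p : (2 : F) • ψ p = 0 := by
      rw [two_smul]
      nth_rewrite 1 [this]
      simp
    rw [(smul_eq_zero.1 h2p).resolve_left h2] at hp
    exact hN (by simpa using hp.symm)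
  refine ((congrArg card ?_).trans (card_pair hp0)).symm
  ext p'
  simp only [mem_insert, mem_singleton, mem_filter, hmemS]
  constructor
  · rintro ⟨hp', hspan⟩
    have : ψ p' ∈ F ∙ ψ p := hspan ▸ Submodule.mem_span_singleton_self _
    obtain ⟨c, hc⟩ := Submodule.mem_span_singleton.1 this
    rw [← hc] at hp'
    simp only [map_smul, LinearMap.smul_apply, smul_eq_mul, hp] at hp'
    have hc2 : c * c = 1 := mul_right_cancel₀ hN (by linear_combination hp')
    rw [← hψsmul] at hc
    rcases mul_self_eq_one_iff.1 hc2 with rfl | rfl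
    · exact Or.inl (by simpa using (hψinj hc).symm)
    · exact Or.inr (by simpa using (hψinj hc).symm)
  · rintro (rfl | rfl)
    · exact ⟨hp, rfl⟩
    · have : ψ (-p) = (-1 : F) • ψ p := by rw [← hψsmul, neg_one_smul]
      rw [this]
      exact ⟨by simpa using hp, Submodule.span_singleton_smul_eq isUnit_one.neg _⟩

theorem card_filter_mul_sq_eq_of_isSquare (h2 : (2 : F) ≠ 0) {γ n : F} (hγ : γ ≠ 0) (hn : n ≠ 0)
    (h : IsSquare (γ * n)) : #{z : F | γ * z ^ 2 = n} = 2 := by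
  obtain ⟨r, hr⟩ := h
  have hr0 : r ≠ 0 := by
    rintro rfl
    simp [hγ, hn] at hr
  have hne : r / γ ≠ -(r / γ) := by
    intro h
    have : 2 * (r / γ) = 0 := by linear_combination h
    simp [h2, hr0, hγ] at this
  refine (congrArg card ?_).trans (card_pair hne)
  ext z
  simp only [mem_filter, mem_univ, true_and, mem_insert, mem_singleton]
  rw [← sq_eq_sq_iff_eq_or_eq_neg, div_pow, eq_div_iff (pow_ne_zero 2 hγ)]
  constructor
  · intro hz
    linear_combination γ * hz + hr
  · intro hz
    exact mul_left_cancel₀ hγ (by linear_combination hz - hr)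

theorem card_filter_mul_sq_eq_of_not_isSquare {γ n : F} (h : ¬ IsSquare (γ * n)) :
    #{z : F | γ * z ^ 2 = n} = 0 := by
  rw [card_eq_zero, filter_eq_empty_iff]
  rintro z - rfl
  exact h ⟨γ * z, by ring⟩

end Counting

/-- The singular points of a line `⟨a, b⟩` with `a` nonsingular correspond to the square roots of
the negated discriminant. -/
theorem ncard_singular_eq (hsymm : ∀ u v, B u v = B v u) {a b : Fin 5 → F} (hN : B a a ≠ 0)
    (hab : b ∉ F ∙ a) :
    {p | Singular B p ∧ p ≤ (F ∙ a) ⊔ (F ∙ b)}.ncard =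
      {z : F | z ^ 2 = -(B a a * B b b - B a b ^ 2)}.ncard := by
  have hne : ∀ s : F, s • a + b ≠ 0 := fun s hs =>
    hab (Submodule.mem_span_singleton.2 ⟨-s, by rw [neg_smul, ← eq_neg_of_add_eq_zero_right hs]⟩)
  have hnorm : ∀ s t : F, B a a * B (s • a + t • b) (s • a + t • b) =
      (B a a * s + t * B a b) ^ 2 + t ^ 2 * (B a a * B b b - B a b ^ 2) := fun s t => by
    simp [hsymm b a]
    ring
  have ha0 : a ≠ 0 := by
    rintro rfl
    simp at hN
  refine (Set.ncard_congr (fun z _ => F ∙ (((z - B a b) / B a a) • a + b)) ?_ ?_ ?_).symm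
  · intro z hz
    refine ⟨⟨finrank_span_singleton (hne _), ?_⟩, ?_⟩
    · intro v hv
      obtain ⟨c, rfl⟩ := Submodule.mem_span_singleton.1 hv
      have := hnorm ((z - B a b) / B a a) 1
      rw [one_smul, mul_div_cancel₀ _ hN, one_mul, sub_add_cancel, hz.out] at this
      simp only [map_smul, LinearMap.smul_apply, smul_eq_mul]
      rw [mul_eq_zero.1 (this.trans (by ring)) |>.resolve_left hN]
      simp
    · rw [Submodule.span_singleton_le_iff_mem]
      exact Submodule.add_mem_sup (Submodule.smul_mem _ _ (Submodule.mem_span_singleton_self a))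
        (Submodule.mem_span_singleton_self b)
  · intro z z' hz hz' h
    have : ((z - B a b) / B a a) • a + b ∈ F ∙ (((z' - B a b) / B a a) • a + b) :=
      h ▸ Submodule.mem_span_singleton_self _
    obtain ⟨c, hc⟩ := Submodule.mem_span_singleton.1 this
    have hcomb : ((1 - c) • b : Fin 5 → F) =
        (c * ((z' - B a b) / B a a) - (z - B a b) / B a a) • a := by
      linear_combination (norm := module) (-1 : F) • hc
    have hc1 : c = 1 := by
      by_contra hc1
      refine hab ((Submodule.smul_mem_iff _ (sub_ne_zero.2 (Ne.symm hc1))).1 ?_)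
      exact hcomb ▸ Submodule.smul_mem _ _ (Submodule.mem_span_singleton_self a)
    rw [hc1, sub_self, zero_smul, eq_comm, smul_eq_zero, or_iff_left ha0] at hcomb
    field_simp at hcomb
    linear_combination -hcomb
  · rintro p ⟨⟨hp1, hp⟩, hple⟩
    obtain ⟨v, hvp, hv0⟩ := Submodule.exists_mem_ne_zero_of_ne_bot
      (show p ≠ ⊥ by rintro rfl; simp at hp1)
    obtain ⟨_, hs, _, ht, rfl⟩ := Submodule.mem_sup.1 (hple hvp)
    obtain ⟨s, rfl⟩ := Submodule.mem_span_singleton.1 hs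
    obtain ⟨t, rfl⟩ := Submodule.mem_span_singleton.1 ht
    have hn := hnorm s t
    rw [hp _ hvp, mul_zero] at hn
    have ht0 : t ≠ 0 := by
      rintro rfl
      have : s = 0 := by simpa [hN] using hn.symm
      simp [this] at hv0
    refine ⟨(B a a * s + t * B a b) / t, ?_, ?_⟩
    · simp only [Set.mem_ofPred_eq]
      field_simp
      linear_combination -hn
    · have hv : (((B a a * s + t * B a b) / t - B a b) / B a a) • a + b =
          t⁻¹ • (s • a + t • b) := by
        rw [smul_add, smul_smul, smul_smul, inv_mul_cancel₀ ht0, one_smul]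
        congr 2
        field_simp
        ring
      rw [hv, Submodule.span_singleton_smul_eq (inv_ne_zero ht0).isUnit]
      have : FiniteDimensional F p := FiniteDimensional.of_finrank_pos (by omega)
      exact Submodule.eq_of_le_of_finrank_eq ((Submodule.span_singleton_le_iff_mem _ _).2 hvp)
        (by rw [hp1, finrank_span_singleton hv0])

end Stmt15

open Stmt15 in
/-- for distinct hyperbolic points x, y of Q(4,q), q odd, with the
line xy not tangent: xy is secant iff |x^⊥ ∩ y^⊥| = q(q+1)/2, and xy is external
iff |x^⊥ ∩ y^⊥| = q(q−1)/2. -/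
theorem stmt15 {F : Type*} [Field F] [Fintype F] (q : ℕ)
    (hq : Fintype.card F = q) (hodd : Odd q)
    (B : LinearMap.BilinForm F (Fin 5 → F))
    (hsymm : ∀ u v, B u v = B v u)
    (hnd : ∀ v, (∀ w, B v w = 0) → v = 0)
    (x y : Submodule F (Fin 5 → F)) (hxy : x ≠ y)
    (hx : HyperPt B x) (hy : HyperPt B y)
    (hnt : {p | Singular B p ∧ p ≤ x ⊔ y}.ncard ≠ 1) :
    ({p | Singular B p ∧ p ≤ x ⊔ y}.ncard = 2 ↔
      (perpSet B x ∩ perpSet B y).ncard = q * (q + 1) / 2) ∧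
    ({p | Singular B p ∧ p ≤ x ⊔ y}.ncard = 0 ↔
      (perpSet B x ∩ perpSet B y).ncard = q * (q - 1) / 2) := by
  classical
  subst hq
  have h2 : (2 : F) ≠ 0 := Ring.two_ne_zero fun h => by
    have := FiniteField.even_card_iff_char_two.1 h
    have := Nat.odd_iff.1 hodd
    omega
  obtain ⟨a, rfl⟩ := hx.exists_eq_span_singleton
  obtain ⟨b, rfl⟩ := hy.exists_eq_span_singleton
  have hN := (hyperPt_span_singleton_iff.1 hx).1
  have hab : b ∉ F ∙ a := fun h => hxy (Submodule.eq_of_le_of_finrank_eq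
    ((Submodule.span_singleton_le_iff_mem _ _).2 h) (hy.1.trans hx.1.symm)).symm
  rw [ncard_singular_eq hsymm hN hab] at hnt ⊢
  have hroots : {z : F | z ^ 2 = -(B a a * B b b - B a b ^ 2)}.ncard =
      (Finset.univ.filter fun z : F => 1 * z ^ 2 = -(B a a * B b b - B a b ^ 2)).card := by
    rw [← Set.ncard_coe_finset]
    simp
  have hD : B a a * B b b - B a b ^ 2 ≠ 0 := fun h => hnt (by simp [h])
  obtain ⟨e, f, g, h⟩ := hx.exists_isAdapted h2 hsymm hnd hD
  have hcount := h.two_mul_ncard_perpSet_inter h2 hsymm hnd hD hx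
  rw [card_filter_ternary h2] at hcount
  obtain ⟨r, hr⟩ := h.exists_sq_eq h2 hsymm hD hx
  have hr0 : r ≠ 0 := by
    rintro rfl
    simp [h.gg, hN] at hr
  have hsq : IsSquare (B g g * B a a) ↔ IsSquare (1 * -(B a a * B b b - B a b ^ 2)) := by
    rw [← hr, one_mul]
    constructor
    · rintro ⟨c, hc⟩
      refine ⟨c / r, ?_⟩
      field_simp
      linear_combination hc
    · rintro ⟨c, hc⟩
      exact ⟨c * r, by rw [hc]; ring⟩
  have hpos : 0 < Fintype.card F := Fintype.card_pos
  generalize Fintype.card F = q at *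
  obtain ⟨m, rfl⟩ : ∃ m, q = m + 1 := ⟨q - 1, by omega⟩
  have hplus : (m + 1) * (m + 1 + 1) = (m + 1) * m + 2 * (m + 1) := by ring
  rw [hroots, hplus]
  simp only [Nat.add_sub_cancel] at hcount ⊢
  by_cases hs : IsSquare (B g g * B a a)
  · rw [card_filter_mul_sq_eq_of_isSquare h2 h.gg hN hs] at hcount
    rw [card_filter_mul_sq_eq_of_isSquare h2 one_ne_zero (neg_ne_zero.2 hD) (hsq.1 hs)]
    omega
  · rw [card_filter_mul_sq_eq_of_not_isSquare hs] at hcount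
    rw [card_filter_mul_sq_eq_of_not_isSquare (hsq.not.1 hs)]
    omega
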